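/- arXiv:1904.12425 — 4 statements merged into one kernel-verified Lean document; each statement's English description precedes it below -/
import Mathlib

section
/- Let k ∈ M₂(ℝ) be an invertible 2×2 real matrix, and let ζ : I → ℝ², χ : I → ℝ, ψ : I → ℝ² be differentiable on a real interval I. Define Υ[χ,ψ](t) = χ'(t) + (1/√3)(ψ₁ψ₂' − ψ₂ψ₁')(t) and Θ[ζ,χ,ψ](t) = ζ'(t) + (χ'(t) + (1/(3√3))(ψ₁ψ₂' − ψ₂ψ₁')(t))·ψ(t). Then for all t ∈ I: Υ[(det k)·χ, kψ](t) = (det k)·Υ[χ,ψ](t), and Θ[(det k)·kζ, (det k)·χ, kψ](t) = (det k)·k·Θ[ζ,χ,ψ](t). -/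
/-- The axis electric 1-form `Υ[χ,ψ](t) = χ'(t) + (1/√3)(ψ₁ψ₂' − ψ₂ψ₁')(t)`. -/
noncomputable def Upsilon (χ : ℝ → ℝ) (ψ : ℝ → Fin 2 → ℝ) (t : ℝ) : ℝ :=
  deriv χ t + (1 / Real.sqrt 3) *
    (ψ t 0 * deriv (fun s => ψ s 1) t - ψ t 1 * deriv (fun s => ψ s 0) t)

/-- The axis twist 1-form
`Θ[ζ,χ,ψ](t) = ζ'(t) + (χ'(t) + (1/(3√3))(ψ₁ψ₂' − ψ₂ψ₁')(t))·ψ(t) ∈ ℝ²`. -/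
noncomputable def Theta (ζ : ℝ → Fin 2 → ℝ) (χ : ℝ → ℝ) (ψ : ℝ → Fin 2 → ℝ) (t : ℝ) :
    Fin 2 → ℝ := fun i =>
  deriv (fun s => ζ s i) t + (deriv χ t + (1 / (3 * Real.sqrt 3)) *
    (ψ t 0 * deriv (fun s => ψ s 1) t - ψ t 1 * deriv (fun s => ψ s 0) t)) * ψ t i

theorem deriv_mulVec_aux (k : Matrix (Fin 2) (Fin 2) ℝ) (f : ℝ → Fin 2 → ℝ) (t : ℝ)
    (hf : ∀ i, DifferentiableAt ℝ (fun s => f s i) t) (i : Fin 2) :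
    deriv (fun s => k.mulVec (f s) i) t
      = k i 0 * deriv (fun s => f s 0) t + k i 1 * deriv (fun s => f s 1) t := by
  have h := ((hf 0).hasDerivAt.const_mul (k i 0)).add ((hf 1).hasDerivAt.const_mul (k i 1))
  rw [← h.deriv]
  congr 1
  funext s
  simp [Matrix.mulVec, dotProduct, Fin.sum_univ_two]

/-- Under the target-space transformation `ψ ↦ kψ`, `χ ↦ (det k)χ`, `ζ ↦ (det k)kζ` for an
invertible `k ∈ M₂(ℝ)`, the 1-forms transform as `Υ ↦ (det k)Υ` and `Θ ↦ (det k)kΘ`. -/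
theorem upsilon_theta_transformation (k : Matrix (Fin 2) (Fin 2) ℝ) (hk : IsUnit k)
    (I : Set ℝ) (hI : I.OrdConnected)
    (ζ : ℝ → Fin 2 → ℝ) (χ : ℝ → ℝ) (ψ : ℝ → Fin 2 → ℝ)
    (hζ : ∀ i, ∀ t ∈ I, DifferentiableAt ℝ (fun s => ζ s i) t)
    (hχ : ∀ t ∈ I, DifferentiableAt ℝ χ t)
    (hψ : ∀ i, ∀ t ∈ I, DifferentiableAt ℝ (fun s => ψ s i) t) :
    ∀ t ∈ I,
      Upsilon (fun s => k.det * χ s) (fun s => k.mulVec (ψ s)) t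
          = k.det * Upsilon χ ψ t ∧
      Theta (fun s => k.det • k.mulVec (ζ s)) (fun s => k.det * χ s)
          (fun s => k.mulVec (ψ s)) t
        = k.det • k.mulVec (Theta ζ χ ψ t) := by
  intro t ht
  have hψ' := deriv_mulVec_aux k ψ t (fun i => hψ i t ht)
  have hζ' : ∀ i, deriv (fun s => (k.det • k.mulVec (ζ s)) i) t
      = k.det * (k i 0 * deriv (fun s => ζ s 0) t + k i 1 * deriv (fun s => ζ s 1) t) := by
    intro i
    rw [← deriv_mulVec_aux k ζ t (fun i => hζ i t ht) i]
    simp only [Pi.smul_apply, smul_eq_mul]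
    exact deriv_const_mul_field _
  have hχ' : deriv (fun s => k.det * χ s) t = k.det * deriv χ t := deriv_const_mul_field _
  have hm : ∀ (v : Fin 2 → ℝ) (i : Fin 2), k.mulVec v i = k i 0 * v 0 + k i 1 * v 1 := by
    intro v i
    simp [Matrix.mulVec, dotProduct, Fin.sum_univ_two]
  constructor
  · unfold Upsilon
    rw [hχ', hψ' 0, hψ' 1]
    beta_reduce
    rw [hm (ψ t) 0, hm (ψ t) 1, Matrix.det_fin_two]
    ring
  · funext i
    rw [Pi.smul_apply, hm (Theta ζ χ ψ t) i, smul_eq_mul]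
    unfold Theta
    rw [hχ', hψ' 0, hψ' 1, hζ' i]
    beta_reduce
    rw [hm (ψ t) 0, hm (ψ t) 1, hm (ψ t) i, Matrix.det_fin_two]
    ring
end

section
/- Let k ≥ 1, let U ⊆ {(ρ,z) ∈ ℝ² : ρ > 0} be open, let G : ℝᵏ → Mₖ(ℝ) be C¹ with symmetric values, and let X : U → ℝᵏ be C² satisfying, for each index A and all (ρ,z) ∈ U, the ρ-weighted harmonic map equation ∂_ρ(ρ G_{AB}(X)∂_ρX^B) + ∂_z(ρ G_{AB}(X)∂_zX^B) = (ρ/2)(∂G_{BC}/∂y^A)(X)(∂_ρX^B∂_ρX^C + ∂_zX^B∂_zX^C) (sums over repeated B,C). Then on U, ∂_z[ρ(G_{AB}(X)∂_ρX^A∂_ρX^B − G_{AB}(X)∂_zX^A∂_zX^B)] = ∂_ρ[2ρ G_{AB}(X)∂_ρX^A∂_zX^B]. -/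
/-- Partial derivative in the first (`ρ`) coordinate of a function on the `(ρ,z)` plane. -/
noncomputable def pdρ (f : ℝ × ℝ → ℝ) (p : ℝ × ℝ) : ℝ := fderiv ℝ f p (1, 0)

/-- Partial derivative in the second (`z`) coordinate of a function on the `(ρ,z)` plane. -/
noncomputable def pdz (f : ℝ × ℝ → ℝ) (p : ℝ × ℝ) : ℝ := fderiv ℝ f p (0, 1)

/-- Partial derivative `∂/∂y^A` of a function on the target `ℝᵏ`. -/
noncomputable def pdk {k : ℕ} (A : Fin k) (f : (Fin k → ℝ) → ℝ) (y : Fin k → ℝ) : ℝ :=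
  fderiv ℝ f y (Pi.single A 1)

lemma whm_fst (p w : ℝ × ℝ) : fderiv ℝ (fun q : ℝ × ℝ => q.1) p w = w.1 := by
  rw [fderiv_fst]; rfl

lemma whm_mul {f g : ℝ × ℝ → ℝ} {p : ℝ × ℝ} (w : ℝ × ℝ) (hf : DifferentiableAt ℝ f p)
    (hg : DifferentiableAt ℝ g p) :
    fderiv ℝ (fun q => f q * g q) p w = fderiv ℝ f p w * g p + f p * fderiv ℝ g p w := by
  rw [fderiv_fun_mul hf hg]
  simp only [ContinuousLinearMap.add_apply, ContinuousLinearMap.smul_apply, smul_eq_mul]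
  ring

lemma whm_sum {k : ℕ} {f : Fin k → ℝ × ℝ → ℝ} {p : ℝ × ℝ} (w : ℝ × ℝ)
    (hf : ∀ A, DifferentiableAt ℝ (f A) p) :
    fderiv ℝ (fun q => ∑ A, f A q) p w = ∑ A, fderiv ℝ (f A) p w := by
  rw [fderiv_fun_sum (fun A _ => hf A)]
  simp

lemma whm_sum1 {k : ℕ} {g u : Fin k → ℝ × ℝ → ℝ} {p : ℝ × ℝ} (w : ℝ × ℝ)
    (hg : ∀ A, DifferentiableAt ℝ (g A) p) (hu : ∀ A, DifferentiableAt ℝ (u A) p) :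
    fderiv ℝ (fun q => q.1 * ∑ A, g A q * u A q) p w
      = ∑ A, (w.1 * (g A p * u A p)
        + p.1 * (fderiv ℝ (g A) p w * u A p + g A p * fderiv ℝ (u A) p w)) := by
  have h : ∀ A, DifferentiableAt ℝ (fun q => g A q * u A q) p := fun A => (hg A).mul (hu A)
  rw [whm_mul w differentiableAt_fst (DifferentiableAt.fun_sum fun A _ => h A), whm_fst,
    whm_sum w h, Finset.mul_sum, Finset.mul_sum, ← Finset.sum_add_distrib]
  refine Finset.sum_congr rfl fun A _ => ?_
  rw [whm_mul w (hg A) (hu A)]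

lemma whm_diff2 {k : ℕ} {g : Fin k → Fin k → ℝ × ℝ → ℝ} {u v : Fin k → ℝ × ℝ → ℝ} {p : ℝ × ℝ}
    (hg : ∀ A B, DifferentiableAt ℝ (g A B) p) (hu : ∀ A, DifferentiableAt ℝ (u A) p)
    (hv : ∀ A, DifferentiableAt ℝ (v A) p) :
    DifferentiableAt ℝ (fun q => ∑ A, ∑ B, g A B q * u A q * v B q) p :=
  DifferentiableAt.fun_sum fun A _ => DifferentiableAt.fun_sum fun B _ =>
    ((hg A B).mul (hu A)).mul (hv B)

lemma whm_sum2 {k : ℕ} {g : Fin k → Fin k → ℝ × ℝ → ℝ} {u v : Fin k → ℝ × ℝ → ℝ} {p : ℝ × ℝ}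
    (w : ℝ × ℝ)
    (hg : ∀ A B, DifferentiableAt ℝ (g A B) p) (hu : ∀ A, DifferentiableAt ℝ (u A) p)
    (hv : ∀ A, DifferentiableAt ℝ (v A) p) :
    fderiv ℝ (fun q => ∑ A, ∑ B, g A B q * u A q * v B q) p w
      = ∑ A, ∑ B, (fderiv ℝ (g A B) p w * u A p * v B p + g A B p * fderiv ℝ (u A) p w * v B p
          + g A B p * u A p * fderiv ℝ (v B) p w) := by
  have h : ∀ A B, DifferentiableAt ℝ (fun q => g A B q * u A q * v B q) p :=
    fun A B => ((hg A B).mul (hu A)).mul (hv B)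
  rw [whm_sum w fun A => DifferentiableAt.fun_sum fun B _ => h A B]
  refine Finset.sum_congr rfl fun A _ => ?_
  rw [whm_sum w (h A)]
  refine Finset.sum_congr rfl fun B _ => ?_
  rw [whm_mul w ((hg A B).fun_mul (hu A)) (hv B), whm_mul w (hg A B) (hu A)]
  ring

/-- The algebraic core, at a point. -/
lemma whm_algebra {k : ℕ} (r : ℝ) (g gr gz : Fin k → Fin k → ℝ) (D : Fin k → Fin k → Fin k → ℝ)
    (u v ur uz vz : Fin k → ℝ) (hs : ∀ A B, g A B = g B A) (hsr : ∀ A B, gr A B = gr B A)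
    (hsz : ∀ A B, gz A B = gz B A)
    (hD : ∀ B C, gz B C = ∑ A, D A B C * v A)
    (h : ∀ A, ∑ B, (1 * (g A B * u B) + r * (gr A B * u B + g A B * ur B))
        + ∑ B, (0 * (g A B * v B) + r * (gz A B * v B + g A B * vz B))
      = (r / 2) * ∑ B, ∑ C, D A B C * (u B * u C + v B * v C)) :
    r * (∑ A, ∑ B, (gz A B * u A * u B + g A B * uz A * u B + g A B * u A * uz B)
        - ∑ A, ∑ B, (gz A B * v A * v B + g A B * vz A * v B + g A B * v A * vz B))
      = 2 * ∑ A, ∑ B, g A B * u A * v B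
        + 2 * r * ∑ A, ∑ B, (gr A B * u A * v B + g A B * ur A * v B + g A B * u A * uz B) := by
  have h1 : ∑ A, ∑ B, ((g A B * u B + r * (gr A B * u B + g A B * ur B)
        + r * (gz A B * v B + g A B * vz B)) * v A
      - (r / 2) * (gz A B * (u A * u B + v A * v B))) = 0 := by
    have e1 : ∑ A, ∑ B, (g A B * u B + r * (gr A B * u B + g A B * ur B)
        + r * (gz A B * v B + g A B * vz B)) * v A
        = ∑ A, ((r / 2) * ∑ B, ∑ C, D A B C * (u B * u C + v B * v C)) * v A := by
      refine Finset.sum_congr rfl fun A _ => ?_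
      rw [← h A, ← Finset.sum_add_distrib, Finset.sum_mul]
      refine Finset.sum_congr rfl fun B _ => ?_
      ring
    have e2 : ∑ A, ((r / 2) * ∑ B, ∑ C, D A B C * (u B * u C + v B * v C)) * v A
        = ∑ B, ∑ C, (r / 2) * (gz B C * (u B * u C + v B * v C)) := by
      simp only [hD, Finset.mul_sum, Finset.sum_mul]
      rw [Finset.sum_comm]
      refine Finset.sum_congr rfl fun B _ => ?_
      rw [Finset.sum_comm]
      refine Finset.sum_congr rfl fun C _ => Finset.sum_congr rfl fun A _ => ?_
      ring
    simp only [Finset.sum_sub_distrib]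
    rw [e1, e2, sub_self]
  set T : Fin k → Fin k → ℝ := fun A B =>
    2 * (g A B * u A * v B)
      + 2 * r * (gr A B * u A * v B + g A B * ur A * v B + g A B * u A * uz B)
      - r * ((gz A B * u A * u B + g A B * uz A * u B + g A B * u A * uz B)
        - (gz A B * v A * v B + g A B * vz A * v B + g A B * v A * vz B)) with hT
  set H : Fin k → Fin k → ℝ := fun A B =>
    (g A B * u B + r * (gr A B * u B + g A B * ur B)
        + r * (gz A B * v B + g A B * vz B)) * v A
      - (r / 2) * (gz A B * (u A * u B + v A * v B)) with hH
  have hTs : ∑ A, ∑ B, T A B = ∑ A, ∑ B, T B A := Finset.sum_comm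
  have hHs : ∑ A, ∑ B, H A B = ∑ A, ∑ B, H B A := Finset.sum_comm
  have key : ∑ A, ∑ B, (T A B + T B A) = ∑ A, ∑ B, 2 * (H A B + H B A) := by
    refine Finset.sum_congr rfl fun A _ => Finset.sum_congr rfl fun B _ => ?_
    simp only [hT, hH]
    rw [hs B A, hsr B A, hsz B A]
    ring
  simp only [← Finset.mul_sum, Finset.sum_add_distrib (f := fun A => ∑ B, T A B),
    Finset.sum_add_distrib] at key
  have h0 : ∑ A, ∑ B, T A B = 0 := by linarith
  simp only [hT, Finset.sum_sub_distrib, Finset.sum_add_distrib, ← Finset.mul_sum] at h0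
  simp only [Finset.sum_add_distrib]
  linarith

/-- If `X` is a `C²` solution of the `ρ`-weighted harmonic map equations on an open set
`U ⊆ {ρ > 0}` with `C¹` symmetric target metric `G`, then
`∂_z[ρ(G_{AB}∂_ρX^A∂_ρX^B − G_{AB}∂_zX^A∂_zX^B)] = ∂_ρ[2ρ G_{AB}∂_ρX^A∂_zX^B]` on `U`,
the integrability condition for the conformal factor `σ`. -/
theorem weighted_harmonic_map_integrability (k : ℕ) (hk : 1 ≤ k)
    (U : Set (ℝ × ℝ)) (hU : IsOpen U) (hU' : ∀ p ∈ U, 0 < p.1)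
    (G : (Fin k → ℝ) → Fin k → Fin k → ℝ) (hG : ContDiff ℝ 1 G)
    (hGsymm : ∀ y A B, G y A B = G y B A)
    (X : ℝ × ℝ → Fin k → ℝ) (hX : ContDiffOn ℝ 2 X U)
    (hharm : ∀ A : Fin k, ∀ p ∈ U,
      pdρ (fun q => q.1 * ∑ B : Fin k, G (X q) A B * pdρ (fun q' => X q' B) q) p
          + pdz (fun q => q.1 * ∑ B : Fin k, G (X q) A B * pdz (fun q' => X q' B) q) p
        = (p.1 / 2) * ∑ B : Fin k, ∑ C : Fin k,
            pdk A (fun y => G y B C) (X p) *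
              (pdρ (fun q => X q B) p * pdρ (fun q => X q C) p
                + pdz (fun q => X q B) p * pdz (fun q => X q C) p)) :
    ∀ p ∈ U,
      pdz (fun q => q.1 *
          ((∑ A : Fin k, ∑ B : Fin k,
              G (X q) A B * pdρ (fun q' => X q' A) q * pdρ (fun q' => X q' B) q)
            - ∑ A : Fin k, ∑ B : Fin k,
                G (X q) A B * pdz (fun q' => X q' A) q * pdz (fun q' => X q' B) q)) p
        = pdρ (fun q => 2 * q.1 * ∑ A : Fin k, ∑ B : Fin k,
            G (X q) A B * pdρ (fun q' => X q' A) q * pdz (fun q' => X q' B) q) p := by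
  intro p hp
  have hXp : ContDiffAt ℝ 2 X p := hX.contDiffAt (hU.mem_nhds hp)
  have hXA : ∀ A, ContDiffAt ℝ 2 (fun q => X q A) p := fun A => contDiffAt_pi.1 hXp A
  have hfd : ∀ A, DifferentiableAt ℝ (fderiv ℝ (fun q => X q A)) p := fun A =>
    ((hXA A).fderiv_right (m := 1) (by norm_num)).differentiableAt (by norm_num)
  have hXd : DifferentiableAt ℝ X p := hXp.differentiableAt (by norm_num)
  have hGd : ∀ A B, Differentiable ℝ (fun y => G y A B) := fun A B =>
    ((contDiff_pi.1 (contDiff_pi.1 hG A)) B).differentiable (by norm_num)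
  have hu : ∀ A, DifferentiableAt ℝ (pdρ (fun q' => X q' A)) p := fun A =>
    (hfd A).clm_apply (differentiableAt_const _)
  have hv : ∀ A, DifferentiableAt ℝ (pdz (fun q' => X q' A)) p := fun A =>
    (hfd A).clm_apply (differentiableAt_const _)
  have hg : ∀ A B, DifferentiableAt ℝ (fun q => G (X q) A B) p := fun A B =>
    ((hGd A B) (X p)).comp p hXd
  have hcl : ∀ (A : Fin k) (w w' : ℝ × ℝ),
      fderiv ℝ (fun q => fderiv ℝ (fun q' => X q' A) q w) p w'
        = fderiv ℝ (fderiv ℝ (fun q' => X q' A)) p w' w := by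
    intro A w w'
    rw [fderiv_clm_apply (hfd A) (differentiableAt_const _)]
    simp
  have hmix : ∀ A, fderiv ℝ (pdρ (fun q' => X q' A)) p (0, 1)
      = fderiv ℝ (pdz (fun q' => X q' A)) p (1, 0) := by
    intro A
    have hsym : IsSymmSndFDerivAt ℝ (fun q => X q A) p :=
      (hXA A).isSymmSndFDerivAt (by simp)
    exact (hcl A (1, 0) (0, 1)).trans ((hsym _ _).trans (hcl A (0, 1) (1, 0)).symm)
  have hchain : ∀ B C, fderiv ℝ (fun q => G (X q) B C) p (0, 1)
      = ∑ A, pdk A (fun y => G y B C) (X p) * pdz (fun q' => X q' A) p := by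
    intro B C
    have e : fderiv ℝ (fun q => G (X q) B C) p
        = (fderiv ℝ (fun y => G y B C) (X p)).comp (fderiv ℝ X p) :=
      fderiv_comp p (hGd B C (X p)) hXd
    have e2 : ∀ A, pdz (fun q' => X q' A) p = fderiv ℝ X p (0, 1) A := by
      intro A
      unfold pdz
      rw [fderiv_apply hXd A]
      rfl
    rw [e, ContinuousLinearMap.comp_apply]
    conv_lhs => rw [pi_eq_sum_univ' (fderiv ℝ X p (0, 1)), map_sum]
    refine Finset.sum_congr rfl fun A _ => ?_
    rw [map_smul, smul_eq_mul, e2, mul_comm]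
    unfold pdk
    congr 2
  have halg := whm_algebra p.1 (fun A B => G (X p) A B)
    (fun A B => fderiv ℝ (fun q => G (X q) A B) p (1, 0))
    (fun A B => fderiv ℝ (fun q => G (X q) A B) p (0, 1))
    (fun A B C => pdk A (fun y => G y B C) (X p))
    (fun A => pdρ (fun q' => X q' A) p) (fun A => pdz (fun q' => X q' A) p)
    (fun A => fderiv ℝ (pdρ (fun q' => X q' A)) p (1, 0))
    (fun A => fderiv ℝ (pdρ (fun q' => X q' A)) p (0, 1))
    (fun A => fderiv ℝ (pdz (fun q' => X q' A)) p (0, 1))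
    (fun A B => hGsymm _ A B) (fun A B => by simp only [hGsymm _ A B])
    (fun A B => by simp only [hGsymm _ A B]) hchain
    (fun A => by
      have h := hharm A p hp
      have a1 := whm_sum1 (1, 0) (hg A) hu
      have a2 := whm_sum1 (0, 1) (hg A) hv
      exact (congrArg₂ (· + ·) a1 a2).symm.trans h)
  have d1 := whm_diff2 hg hu hu
  have d2 := whm_diff2 hg hv hv
  have d3 := whm_diff2 hg hu hv
  have l1 := whm_mul (0, 1) (differentiableAt_fst (𝕜 := ℝ) (p := p)) (d1.fun_sub d2)
  rw [whm_fst, fderiv_fun_sub d1 d2, ContinuousLinearMap.sub_apply, whm_sum2 _ hg hu hu,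
    whm_sum2 _ hg hv hv] at l1
  have l2 := whm_mul (1, 0) ((differentiableAt_fst (𝕜 := ℝ) (p := p)).const_mul 2) d3
  rw [fderiv_const_mul differentiableAt_fst, ContinuousLinearMap.smul_apply, whm_fst,
    whm_sum2 _ hg hu hv] at l2
  refine l1.trans (Eq.trans ?_ l2.symm)
  simp only [hmix] at halg ⊢
  rw [zero_mul, zero_add, halg]
  simp
end

section
/- Let A = {(0,0,z) : z ∈ ℝ} ⊂ ℝ³ be the z-axis. Suppose u : ℝ³ → ℝ is continuous and bounded, is twice continuously differentiable on ℝ³ ∖ A with Euclidean Laplacian Δu(x) ≥ 0 for all x ∈ ℝ³ ∖ A, and satisfies u(x) → 0 as |x| → ∞. Then u(x) ≤ 0 for all x ∈ ℝ³. -/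
/-- The partial derivative `∂ᵢ f(x)` of a function `f : ℝⁿ → ℝ` in the `i`-th
coordinate direction. -/
noncomputable def pd {n : ℕ} (i : Fin n) (f : (Fin n → ℝ) → ℝ) (x : Fin n → ℝ) : ℝ :=
  fderiv ℝ f x (Pi.single i 1)

open Filter Topology

lemma second_deriv_le (f f' : ℝ → ℝ) (c : ℝ) (h : ∀ᶠ t in 𝓝 (0:ℝ), HasDerivAt f (f' t) t)
    (h2 : HasDerivAt f' c 0) (hm : IsLocalMax f 0) : c ≤ 0 := by
  by_contra hc
  push Not at hc
  have e : deriv f =ᶠ[𝓝 0] f' := h.mono fun t ht => ht.deriv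
  have e2 : deriv (deriv f) 0 = c := by rw [e.deriv_eq, h2.deriv]
  have hmin : IsLocalMin f 0 := isLocalMin_of_deriv_deriv_pos (by rw [e2]; exact hc)
    hm.deriv_eq_zero h.self_of_nhds.continuousAt
  have e3 : f =ᶠ[𝓝 0] fun _ => f 0 := by
    filter_upwards [hm, hmin] with t h1 h2
    exact le_antisymm h1 h2
  have e4 : deriv f =ᶠ[𝓝 0] fun _ => (0:ℝ) := by
    filter_upwards [e3.deriv] with t ht
    simpa using ht
  have := e4.deriv_eq
  rw [e2] at this
  simp at this
  linarith

lemma line_hasDerivAt (i : Fin 3) (x : Fin 3 → ℝ) (t : ℝ) :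
    HasDerivAt (fun t : ℝ => x + t • (Pi.single i (1:ℝ) : Fin 3 → ℝ)) (Pi.single i 1) t := by
  simpa using ((hasDerivAt_id t).smul_const (Pi.single i (1:ℝ) : Fin 3 → ℝ)).const_add x

/-- The derivatives of a `C²` function along a coordinate line. -/
lemma line_derivs (u : (Fin 3 → ℝ) → ℝ) (i : Fin 3) (x : Fin 3 → ℝ) (h : ContDiffAt ℝ 2 u x) :
    (∀ᶠ t in 𝓝 (0:ℝ), HasDerivAt (fun t : ℝ => u (x + t • (Pi.single i (1:ℝ) : Fin 3 → ℝ)))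
      (pd i u (x + t • (Pi.single i (1:ℝ) : Fin 3 → ℝ))) t) ∧
    HasDerivAt (fun t : ℝ => pd i u (x + t • (Pi.single i (1:ℝ) : Fin 3 → ℝ)))
      (pd i (fun y => pd i u y) x) 0 := by
  have hx0 : x + (0:ℝ) • (Pi.single i (1:ℝ) : Fin 3 → ℝ) = x := by simp
  constructor
  · have hev : ∀ᶠ y in 𝓝 x, DifferentiableAt ℝ u y := by
      have := h.eventually (by simp)
      exact this.mono fun y hy => hy.differentiableAt (by simp)
    have hc : Tendsto (fun t : ℝ => x + t • (Pi.single i (1:ℝ) : Fin 3 → ℝ)) (𝓝 0) (𝓝 x) := by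
      have := (line_hasDerivAt i x 0).continuousAt.tendsto
      rwa [hx0] at this
    filter_upwards [hc.eventually hev] with t ht
    exact ht.hasFDerivAt.comp_hasDerivAt t (line_hasDerivAt i x t)
  · have hd : DifferentiableAt ℝ (fun y => pd i u y) x := by
      have h1 : ContDiffAt ℝ 1 (fderiv ℝ u) x := h.fderiv_right (by norm_num)
      exact (h1.differentiableAt (by simp)).clm_apply (differentiableAt_const _)
    have hd' := hd.hasFDerivAt
    rw [← hx0] at hd'
    have := hd'.comp_hasDerivAt (0:ℝ) (line_hasDerivAt i x 0)
    rw [hx0] at this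
    exact this

lemma barrier_derivs (ε δ L a b c : ℝ) (hab : 0 < a ^ 2 + b ^ 2) :
    (∀ᶠ t in 𝓝 (0:ℝ), HasDerivAt
      (fun t : ℝ => ε * (Real.log ((a + t) ^ 2 + b ^ 2) - L) + δ * ((a + t) ^ 2 + c))
      (ε * (2 * (a + t) / ((a + t) ^ 2 + b ^ 2)) + δ * (2 * (a + t))) t) ∧
    HasDerivAt (fun t : ℝ => ε * (2 * (a + t) / ((a + t) ^ 2 + b ^ 2)) + δ * (2 * (a + t)))
      (ε * (2 * (b ^ 2 - a ^ 2) / (a ^ 2 + b ^ 2) ^ 2) + 2 * δ) 0 := by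
  have hl : ∀ t : ℝ, HasDerivAt (fun t : ℝ => a + t) 1 t := fun t => (hasDerivAt_id t).const_add a
  have hs : ∀ t : ℝ, HasDerivAt (fun t : ℝ => (a + t) ^ 2) (2 * (a + t)) t := fun t => by
    exact ((hl t).fun_pow 2).congr_deriv (by norm_num)
  constructor
  · have : ∀ᶠ t in 𝓝 (0:ℝ), 0 < (a + t) ^ 2 + b ^ 2 := by
      have hc : ContinuousAt (fun t : ℝ => (a + t) ^ 2 + b ^ 2) 0 := by fun_prop
      exact hc.eventually (lt_mem_nhds (by simpa using hab))
    filter_upwards [this] with t ht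
    exact (((((hs t).add_const (b ^ 2)).log ht.ne').sub_const L).const_mul ε).add
      (((hs t).add_const c).const_mul δ)
  · have h := ((((hl 0).const_mul 2).div ((hs 0).add_const (b ^ 2))
      (by simpa using hab.ne')).const_mul ε).add (((hl 0).const_mul 2).const_mul δ)
    refine h.congr_deriv ?_
    simp only [add_zero]
    have := hab.ne'
    field_simp
    ring

lemma quad_derivs (δ k c d : ℝ) :
    (∀ᶠ t in 𝓝 (0:ℝ), HasDerivAt (fun t : ℝ => k + δ * (c + (d + t) ^ 2)) (δ * (2 * (d + t))) t) ∧
    HasDerivAt (fun t : ℝ => δ * (2 * (d + t))) (2 * δ) 0 := by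
  have hl : ∀ t : ℝ, HasDerivAt (fun t : ℝ => d + t) 1 t := fun t => (hasDerivAt_id t).const_add d
  have hs : ∀ t : ℝ, HasDerivAt (fun t : ℝ => (d + t) ^ 2) (2 * (d + t)) t := fun t => by
    exact ((hl t).fun_pow 2).congr_deriv (by norm_num)
  refine ⟨Eventually.of_forall fun t => (((hs t).const_add c).const_mul δ).const_add k, ?_⟩
  exact (((hl 0).const_mul 2).const_mul δ).congr_deriv (by ring)

/-- No interior local maximum for the perturbed function off the axis. -/
lemma no_local_max (u : (Fin 3 → ℝ) → ℝ) (x : Fin 3 → ℝ) (h : ContDiffAt ℝ 2 u x)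
    (hsub : 0 ≤ ∑ i : Fin 3, pd i (fun y => pd i u y) x) (ε δ L : ℝ) (hδ : 0 < δ)
    (hx : 0 < x 0 ^ 2 + x 1 ^ 2)
    (hm : IsLocalMax (fun y : Fin 3 → ℝ => u y + (ε * (Real.log (y 0 ^ 2 + y 1 ^ 2) - L)
      + δ * (y 0 ^ 2 + y 1 ^ 2 + y 2 ^ 2))) x) : False := by
  have hline : ∀ i : Fin 3, IsLocalMax (fun t : ℝ => (fun y : Fin 3 → ℝ =>
      u y + (ε * (Real.log (y 0 ^ 2 + y 1 ^ 2) - L)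
      + δ * (y 0 ^ 2 + y 1 ^ 2 + y 2 ^ 2))) (x + t • (Pi.single i (1:ℝ) : Fin 3 → ℝ))) 0 := by
    intro i
    have hx0 : x + (0:ℝ) • (Pi.single i (1:ℝ) : Fin 3 → ℝ) = x := by simp
    rw [← hx0] at hm
    exact hm.comp_continuous (g := fun t : ℝ => x + t • (Pi.single i (1:ℝ) : Fin 3 → ℝ))
      (line_hasDerivAt i x 0).continuousAt
  have b0 := barrier_derivs ε δ L (x 0) (x 1) (x 1 ^ 2 + x 2 ^ 2) hx
  have b1 := barrier_derivs ε δ L (x 1) (x 0) (x 0 ^ 2 + x 2 ^ 2) (by linarith)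
  have b2 := quad_derivs δ (ε * (Real.log (x 0 ^ 2 + x 1 ^ 2) - L)) (x 0 ^ 2 + x 1 ^ 2) (x 2)
  have l0 := line_derivs u 0 x h
  have l1 := line_derivs u 1 x h
  have l2 := line_derivs u 2 x h
  have r0 := second_deriv_le _ _ _ ((l0.1.and b0.1).mono fun t ht => ht.1.add ht.2)
    (l0.2.add b0.2) (by
      convert hline 0 using 1
      funext t
      simp
      left
      ring)
  have r1 := second_deriv_le _ _ _ ((l1.1.and b1.1).mono fun t ht => ht.1.add ht.2)
    (l1.2.add b1.2) (by
      convert hline 1 using 1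
      funext t
      simp
      rw [add_comm ((x 1 + t) ^ 2) (x 0 ^ 2)]
      ring)
  have r2 := second_deriv_le _ _ _ ((l2.1.and b2.1).mono fun t ht => ht.1.add ht.2)
    (l2.2.add b2.2) (by
      convert hline 2 using 1
      funext t
      simp)
  rw [Fin.sum_univ_three] at hsub
  have hz : ε * (2 * (x 1 ^ 2 - x 0 ^ 2) / (x 0 ^ 2 + x 1 ^ 2) ^ 2) +
      ε * (2 * (x 0 ^ 2 - x 1 ^ 2) / (x 1 ^ 2 + x 0 ^ 2) ^ 2) = 0 := by
    rw [add_comm (x 1 ^ 2) (x 0 ^ 2)]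
    ring
  linarith

theorem off_axis (u : (Fin 3 → ℝ) → ℝ)
    (A : Set (Fin 3 → ℝ)) (hA : A = {x | x 0 = 0 ∧ x 1 = 0})
    (hu_cont : Continuous u) (hu_bdd : ∃ C, ∀ x, |u x| ≤ C)
    (hu_C2 : ContDiffOn ℝ 2 u Aᶜ)
    (hsub : ∀ x ∉ A, 0 ≤ ∑ i : Fin 3, pd i (fun y => pd i u y) x)
    (hdecay : Filter.Tendsto u (Filter.cocompact (Fin 3 → ℝ)) (nhds 0))
    (p : Fin 3 → ℝ) (hp : 0 < p 0 ^ 2 + p 1 ^ 2) : u p ≤ 0 := by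
  by_contra hm
  push Not at hm
  set m := u p with hmdef
  obtain ⟨C, hC⟩ := hu_bdd
  have hAc : IsClosed A := by
    rw [hA]
    exact (isClosed_eq (continuous_apply 0) continuous_const).inter
      (isClosed_eq (continuous_apply 1) continuous_const)
  have hnA : ∀ x : Fin 3 → ℝ, 0 < x 0 ^ 2 + x 1 ^ 2 → x ∉ A := by
    intro x hx hxA
    rw [hA] at hxA
    obtain ⟨h0, h1⟩ := hxA
    rw [h0, h1] at hx
    norm_num at hx
  obtain ⟨R, hR0, hpR, hR⟩ : ∃ R : ℝ, 0 < R ∧ ‖p‖ ≤ R ∧ ∀ x, R ≤ ‖x‖ → u x < m / 4 := by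
    have h1 : ∀ᶠ x in cocompact (Fin 3 → ℝ), u x < m / 4 :=
      hdecay.eventually (gt_mem_nhds (by linarith))
    obtain ⟨K, hK, hKs⟩ := mem_cocompact.1 h1
    obtain ⟨r, hr⟩ := hK.isBounded.subset_closedBall 0
    refine ⟨|r| + ‖p‖ + 1, by positivity, by linarith [abs_nonneg r], fun x hx => ?_⟩
    apply hKs
    intro hxK
    have := hr hxK
    rw [mem_closedBall_zero_iff] at this
    linarith [le_abs_self r, norm_nonneg p]
  have hcoord : ∀ x : Fin 3 → ℝ, ‖x‖ ≤ R → ∀ i, x i ^ 2 ≤ R ^ 2 := by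
    intro x hx i
    have := (norm_le_pi_norm x i).trans hx
    rw [Real.norm_eq_abs] at this
    exact sq_le_sq' (by linarith [neg_abs_le (x i)]) (le_of_abs_le this)
  set L := Real.log (2 * R ^ 2) with hL
  have hlog : ∀ x : Fin 3 → ℝ, ‖x‖ ≤ R → 0 < x 0 ^ 2 + x 1 ^ 2 →
      Real.log (x 0 ^ 2 + x 1 ^ 2) - L ≤ 0 := by
    intro x hx h0
    have := Real.log_le_log h0 (show x 0 ^ 2 + x 1 ^ 2 ≤ 2 * R ^ 2 by
      linarith [hcoord x hx 0, hcoord x hx 1])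
    linarith
  obtain ⟨δ, hδ, hδR⟩ : ∃ δ : ℝ, 0 < δ ∧ δ * (3 * R ^ 2) = m / 4 :=
    ⟨m / 4 / (3 * R ^ 2), by positivity, by field_simp⟩
  have hquad : ∀ x : Fin 3 → ℝ, ‖x‖ ≤ R → δ * (x 0 ^ 2 + x 1 ^ 2 + x 2 ^ 2) ≤ m / 4 := by
    intro x hx
    rw [← hδR]
    apply mul_le_mul_of_nonneg_left _ hδ.le
    linarith [hcoord x hx 0, hcoord x hx 1, hcoord x hx 2]
  obtain ⟨ε, hε, hεp⟩ : ∃ ε : ℝ, 0 < ε ∧ -(m / 4) ≤ ε * (Real.log (p 0 ^ 2 + p 1 ^ 2) - L) := by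
    set q := Real.log (p 0 ^ 2 + p 1 ^ 2) - L with hq
    refine ⟨m / 4 / (|q| + 1), by positivity, ?_⟩
    have h1 : m / 4 / (|q| + 1) * (-(|q| + 1)) ≤ m / 4 / (|q| + 1) * q :=
      mul_le_mul_of_nonneg_left (by linarith [neg_abs_le q]) (by positivity)
    have h2 : m / 4 / (|q| + 1) * (-(|q| + 1)) = -(m / 4) := by
      have : |q| + 1 ≠ 0 := by positivity
      field_simp
    linarith
  -- threshold near the axis
  set η := Real.exp (L - C / ε) with hη
  have hη0 : 0 < η := Real.exp_pos _
  set v : (Fin 3 → ℝ) → ℝ := fun y => u y + (ε * (Real.log (y 0 ^ 2 + y 1 ^ 2) - L)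
      + δ * (y 0 ^ 2 + y 1 ^ 2 + y 2 ^ 2)) with hv
  have hnear : ∀ x : Fin 3 → ℝ, ‖x‖ ≤ R → 0 < x 0 ^ 2 + x 1 ^ 2 → x 0 ^ 2 + x 1 ^ 2 ≤ η →
      v x ≤ m / 4 := by
    intro x hx h0 h1
    have h2 := Real.log_le_log h0 h1
    rw [hη, Real.log_exp] at h2
    have h3 : ε * (Real.log (x 0 ^ 2 + x 1 ^ 2) - L) ≤ ε * (-(C / ε)) :=
      mul_le_mul_of_nonneg_left (by linarith) hε.le
    have h4 : ε * (-(C / ε)) = -C := by field_simp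
    have h5 := le_of_abs_le (hC x)
    have h6 := hquad x hx
    simp only [hv]
    linarith
  have hvp : 3 * m / 4 ≤ v p := by
    have : 0 ≤ δ * (p 0 ^ 2 + p 1 ^ 2 + p 2 ^ 2) := by positivity
    simp only [hv]
    linarith
  set K : Set (Fin 3 → ℝ) := Metric.closedBall 0 R ∩ {x | η ≤ x 0 ^ 2 + x 1 ^ 2} with hK
  have hρ : Continuous fun x : Fin 3 → ℝ => x 0 ^ 2 + x 1 ^ 2 := by fun_prop
  have hKc : IsCompact K :=
    (isCompact_closedBall 0 R).inter_right (isClosed_le continuous_const hρ)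
  have hpK : p ∈ K := by
    refine ⟨by simpa using hpR, ?_⟩
    by_contra hlt
    have hlt' : p 0 ^ 2 + p 1 ^ 2 < η := not_le.1 hlt
    linarith [hnear p hpR hp hlt'.le]
  have hvc : ContinuousOn v K := by
    apply hu_cont.continuousOn.add
    apply ContinuousOn.add
    · apply continuousOn_const.mul
      apply ContinuousOn.sub _ continuousOn_const
      exact hρ.continuousOn.log fun x hx => (hη0.trans_le hx.2).ne'
    · exact Continuous.continuousOn (by fun_prop)
  obtain ⟨x, hxK, hmax⟩ := hKc.exists_isMaxOn ⟨p, hpK⟩ hvc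
  have hvx : 3 * m / 4 ≤ v x := hvp.trans (hmax hpK)
  have hxR : ‖x‖ ≤ R := by simpa using hxK.1
  have hx0 : 0 < x 0 ^ 2 + x 1 ^ 2 := hη0.trans_le hxK.2
  have hxR' : ‖x‖ < R := by
    by_contra hge
    have h1 := hR x (not_lt.1 hge)
    have h2 := hquad x hxR
    have h3 := mul_nonpos_of_nonneg_of_nonpos hε.le (hlog x hxR hx0)
    simp only [hv] at hvx
    linarith
  have hxη : η < x 0 ^ 2 + x 1 ^ 2 := by
    by_contra hge
    linarith [hnear x hxR hx0 (not_lt.1 hge)]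
  have hKn : K ∈ 𝓝 x := by
    filter_upwards [continuous_norm.continuousAt.eventually (gt_mem_nhds hxR'),
      hρ.continuousAt.eventually (lt_mem_nhds hxη)] with y h1 h2
    exact ⟨by simpa using h1.le, h2.le⟩
  have hxA := hnA x hx0
  exact no_local_max u x (hu_C2.contDiffAt (hAc.isOpen_compl.mem_nhds hxA)) (hsub x hxA) ε δ L hδ
    hx0 (hmax.isLocalMax hKn)

/-- Maximum principle with singular set on the `z`-axis `A ⊂ ℝ³`: a continuous bounded
function that is `C²` and subharmonic on `ℝ³ ∖ A` and tends to `0` at infinity is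
nonpositive everywhere. -/
theorem max_principle_axis_singular_set (u : (Fin 3 → ℝ) → ℝ)
    (A : Set (Fin 3 → ℝ)) (hA : A = {x | x 0 = 0 ∧ x 1 = 0})
    (hu_cont : Continuous u) (hu_bdd : ∃ C, ∀ x, |u x| ≤ C)
    (hu_C2 : ContDiffOn ℝ 2 u Aᶜ)
    (hsub : ∀ x ∉ A, 0 ≤ ∑ i : Fin 3, pd i (fun y => pd i u y) x)
    (hdecay : Filter.Tendsto u (Filter.cocompact (Fin 3 → ℝ)) (nhds 0)) :
    ∀ x, u x ≤ 0 := by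
  intro x
  have hoff := off_axis u A hA hu_cont hu_bdd hu_C2 hsub hdecay
  by_cases hx : 0 < x 0 ^ 2 + x 1 ^ 2
  · exact hoff x hx
  have hx0 : x 0 = 0 := by nlinarith [sq_nonneg (x 0), sq_nonneg (x 1)]
  have hc : Tendsto (fun t : ℝ => u (x + t • (Pi.single 0 (1:ℝ) : Fin 3 → ℝ))) (𝓝[>] 0)
      (𝓝 (u x)) := by
    have h1 : Continuous (fun t : ℝ => u (x + t • (Pi.single 0 (1:ℝ) : Fin 3 → ℝ))) := by fun_prop
    have h2 := h1.tendsto 0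
    simp only [zero_smul, add_zero] at h2
    exact h2.mono_left nhdsWithin_le_nhds
  refine le_of_tendsto hc ?_
  filter_upwards [self_mem_nhdsWithin] with t ht
  apply hoff
  have ht' : 0 < t := ht
  simp [hx0]
  positivity
end

section
/- Let g : ℝ³ → ℝ be continuous with 0 ≤ g(x) ≤ C(1+|x|²)^{-3/2} for all x ∈ ℝ³ and some constant C > 0. Then there exists a smooth function w : ℝ³ → ℝ with w(x) > 0 for all x, Δw(x) ≤ −g(x) for all x ∈ ℝ³ (Δ the Euclidean Laplacian), and w(x) → 0 as |x| → ∞. -/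
/-- The weight `1 + |x|²` (Euclidean). -/
noncomputable def uu (y : Fin 3 → ℝ) : ℝ := 1 + ∑ j : Fin 3, y j ^ 2

lemma uu_ge (y : Fin 3 → ℝ) : 1 ≤ uu y := by
  have : 0 ≤ ∑ j : Fin 3, y j ^ 2 := Finset.sum_nonneg fun j _ => sq_nonneg _
  unfold uu; linarith

lemma uu_pos (y : Fin 3 → ℝ) : 0 < uu y := by linarith [uu_ge y]

lemma uu_hasFDerivAt (y : Fin 3 → ℝ) :
    HasFDerivAt uu (∑ j : Fin 3, (2 * y j) • ContinuousLinearMap.proj (R := ℝ)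
      (φ := fun _ : Fin 3 => ℝ) j) y := by
  unfold uu
  refine HasFDerivAt.const_add 1 (HasFDerivAt.fun_sum fun j _ => ?_)
  have h := (hasFDerivAt_apply (𝕜 := ℝ) j y).pow 2
  refine h.congr_fderiv ?_
  simp

lemma rpow_hasFDerivAt (p : ℝ) (y : Fin 3 → ℝ) :
    HasFDerivAt (fun z => uu z ^ p) ((p * uu y ^ (p - 1)) •
      ∑ j : Fin 3, (2 * y j) • ContinuousLinearMap.proj (R := ℝ)
      (φ := fun _ : Fin 3 => ℝ) j) y :=
  (uu_hasFDerivAt y).rpow_const (Or.inl (uu_pos y).ne')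

lemma pd_w (K p : ℝ) (i : Fin 3) (y : Fin 3 → ℝ) :
    pd i (fun z => K * uu z ^ p) y = K * (p * uu y ^ (p - 1)) * (2 * y i) := by
  unfold pd
  rw [((rpow_hasFDerivAt p y).const_mul K).fderiv]
  simp [Pi.single_apply]
  ring

lemma pd_pd_w (K p : ℝ) (i : Fin 3) (y : Fin 3 → ℝ) :
    pd i (fun z => pd i (fun z => K * uu z ^ p) z) y =
      2 * K * p * (uu y ^ (p - 1) + 2 * (p - 1) * uu y ^ (p - 2) * y i ^ 2) := by
  have : (fun z => pd i (fun z => K * uu z ^ p) z) =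
      fun z => (2 * K * p) * (uu z ^ (p - 1) * z i) := by
    funext z; rw [pd_w]; ring
  rw [this]
  unfold pd
  rw [(((rpow_hasFDerivAt (p - 1) y).fun_mul (hasFDerivAt_apply (𝕜 := ℝ) i y)).const_mul
    (2 * K * p)).fderiv]
  have e : p - 1 - 1 = p - 2 := by ring
  simp [Pi.single_apply, e]
  ring

lemma norm_sq_le (x : Fin 3 → ℝ) : 1 + ‖x‖ ^ 2 ≤ uu x := by
  have h : ‖x‖ ≤ √(∑ j : Fin 3, x j ^ 2) := by
    refine (pi_norm_le_iff_of_nonneg (Real.sqrt_nonneg _)).2 fun i => ?_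
    refine Real.le_sqrt_of_sq_le ?_
    rw [Real.norm_eq_abs, sq_abs]
    exact Finset.single_le_sum (f := fun j => x j ^ 2) (fun j _ => sq_nonneg _)
      (Finset.mem_univ i)
  have h2 : ‖x‖ ^ 2 ≤ ∑ j : Fin 3, x j ^ 2 := by
    rw [← Real.sq_sqrt (Finset.sum_nonneg fun j _ => sq_nonneg (x j))]
    gcongr
  unfold uu; linarith

lemma uu_le (x : Fin 3 → ℝ) : uu x / 3 ≤ 1 + ‖x‖ ^ 2 := by
  have h : ∀ i, x i ^ 2 ≤ ‖x‖ ^ 2 := fun i => by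
    rw [← sq_abs, ← Real.norm_eq_abs]
    gcongr
    exact norm_le_pi_norm x i
  unfold uu
  rw [Fin.sum_univ_three]
  linarith [h 0, h 1, h 2]

/-- For continuous `g : ℝ³ → ℝ` with `0 ≤ g(x) ≤ C(1+|x|²)^{-3/2}`, there is a smooth
positive supersolution `w` with `Δw ≤ −g` on `ℝ³` and `w → 0` at infinity. -/
theorem exists_positive_supersolution (g : (Fin 3 → ℝ) → ℝ) (hg_cont : Continuous g)
    (C : ℝ) (hC : 0 < C)
    (hg : ∀ x, 0 ≤ g x ∧ g x ≤ C * (1 + ‖x‖ ^ 2) ^ (-(3 : ℝ) / 2)) :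
    ∃ w : (Fin 3 → ℝ) → ℝ,
      ContDiff ℝ (⊤ : ℕ∞) w ∧ (∀ x, 0 < w x) ∧
      (∀ x, (∑ i : Fin 3, pd i (fun y => pd i w y) x) ≤ -g x) ∧
      Filter.Tendsto w (Filter.cocompact (Fin 3 → ℝ)) (nhds 0) := by
  have h3 : (0 : ℝ) < (1 / 3 : ℝ) ^ (-(3 : ℝ) / 2) := by positivity
  set K : ℝ := 4 * ((1 / 3 : ℝ) ^ (-(3 : ℝ) / 2) * C) with hK
  have hKpos : 0 < K := by positivity
  refine ⟨fun x => K * uu x ^ (-(1 / 4) : ℝ), ?_, ?_, ?_, ?_⟩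
  · have hu : ContDiff ℝ (⊤ : ℕ∞) uu := by unfold uu; fun_prop
    exact contDiff_const.mul (hu.rpow_const_of_ne fun x => (uu_pos x).ne')
  · intro x
    exact mul_pos hKpos (Real.rpow_pos_of_pos (uu_pos x) _)
  · intro x
    simp only [pd_pd_w]
    have hu := uu_pos x
    have e1 : uu x ^ (-(1 / 4) - 1 : ℝ) = uu x ^ (-(1 / 4) - 2 : ℝ) * uu x := by
      rw [← Real.rpow_add_one hu.ne']; norm_num
    have hs : x 0 ^ 2 + x 1 ^ 2 + x 2 ^ 2 = uu x - 1 := by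
      unfold uu; rw [Fin.sum_univ_three]; ring
    have hb : 0 < uu x ^ (-(1 / 4) - 2 : ℝ) := Real.rpow_pos_of_pos hu _
    have h5 : uu x ^ (-(3 : ℝ) / 2) ≤ uu x ^ (-(1 / 4) - 2 : ℝ) * uu x := by
      rw [← e1]
      exact Real.rpow_le_rpow_of_exponent_le (uu_ge x) (by norm_num)
    have h6 : (1 + ‖x‖ ^ 2) ^ (-(3 : ℝ) / 2) ≤
        (1 / 3 : ℝ) ^ (-(3 : ℝ) / 2) * uu x ^ (-(3 : ℝ) / 2) := by
      rw [← Real.mul_rpow (by norm_num) hu.le]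
      refine Real.rpow_le_rpow_of_nonpos (by positivity) ?_ (by norm_num)
      linarith [uu_le x]
    have h7 : g x ≤ K / 4 * (uu x ^ (-(1 / 4) - 2 : ℝ) * uu x) := by
      calc g x ≤ C * (1 + ‖x‖ ^ 2) ^ (-(3 : ℝ) / 2) := (hg x).2
        _ ≤ C * ((1 / 3 : ℝ) ^ (-(3 : ℝ) / 2) * uu x ^ (-(3 : ℝ) / 2)) := by gcongr
        _ = K / 4 * uu x ^ (-(3 : ℝ) / 2) := by rw [hK]; ring
        _ ≤ _ := by gcongr
    rw [Fin.sum_univ_three, e1]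
    generalize uu x ^ (-(1 / 4) - 2 : ℝ) = b at *
    have h8 : x 0 ^ 2 = uu x - 1 - x 1 ^ 2 - x 2 ^ 2 := by linarith
    rw [h8]
    have h9 : 0 < K * b := by positivity
    nlinarith
  · have hn : Filter.Tendsto (fun x : Fin 3 → ℝ => uu x) (Filter.cocompact _) Filter.atTop := by
      refine Filter.tendsto_atTop_mono (fun x => ?_) (tendsto_norm_cocompact_atTop (E := Fin 3 → ℝ))
      nlinarith [norm_sq_le x, sq_nonneg (‖x‖ - 1)]
    have := ((tendsto_rpow_neg_atTop (y := 1 / 4) (by norm_num)).comp hn).const_mul K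
    simpa using this
end
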